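/- Let (H, α) be a monoidal Hom-Hopf T-coalgebra over G with bijective antipode, (M, μ) ∈ YD_p, (N, ν) ∈ YD_q, (X, η) ∈ YD_s. With ^NX = ^qX, ^{M⊗N}X = ^{pq}X identified with ^M(^NX), c as defined, and the Hom-associator ã_{A,B,C}((a ⊗ b) ⊗ c) = φ_A(a) ⊗ (b ⊗ φ_C^{-1}(c)), the second hexagon axiom holds: ã^{-1}_{^{M⊗N}X,M,N} ∘ c_{M⊗N,X} ∘ ã^{-1}_{M,N,X} = (c_{M,^NX} ⊗ id_N) ∘ ã^{-1}_{M,^NX,N} ∘ (id_M ⊗ c_{N,X}), as maps M ⊗ (N ⊗ X) → (^{M⊗N}X ⊗ M) ⊗ N. -/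

import Mathlib

open TensorProduct

noncomputable section

section Cast

variable (k : Type*) [Field k] {G : Type*} [Group G] {H : G → Type*}
  [∀ p, AddCommGroup (H p)] [∀ p, Module k (H p)]

/-- Transport of components along an equality of group elements. -/
def cst {a b : G} (h : a = b) : H a →ₗ[k] H b := by subst h; exact LinearMap.id

/-- Transport of components along an equality of group elements, as a linear equivalence. -/
def cstE {a b : G} (h : a = b) : H a ≃ₗ[k] H b := by subst h; exact LinearEquiv.refl k (H a)

end Cast

/-- A (classical) Hopf group-coalgebra over a group `G`. -/
structure HopfGC (k : Type*) [Field k] (G : Type*) [Group G] (H : G → Type*)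
    [∀ p, AddCommGroup (H p)] [∀ p, Module k (H p)] where
  mul : ∀ p : G, H p →ₗ[k] H p →ₗ[k] H p
  one : ∀ p : G, H p
  comul : ∀ p q : G, H (p * q) →ₗ[k] H p ⊗[k] H q
  counit : H (1 : G) →ₗ[k] k
  antipode : ∀ p : G, H p →ₗ[k] H p⁻¹
  mul_assoc' : ∀ (p : G) (a b c : H p), mul p (mul p a b) c = mul p a (mul p b c)
  one_mul' : ∀ (p : G) (a : H p), mul p (one p) a = a
  mul_one' : ∀ (p : G) (a : H p), mul p a (one p) = a
  coassoc : ∀ p q r : G,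
    (TensorProduct.assoc k (H p) (H q) (H r)).toLinearMap.comp
      ((TensorProduct.map (comul p q) LinearMap.id).comp (comul (p * q) r))
    = (TensorProduct.map LinearMap.id (comul q r)).comp
        ((comul p (q * r)).comp (cst k (mul_assoc p q r)))
  counit_comul' : ∀ (p : G) (c : H p),
    (TensorProduct.lid k (H p))
      ((TensorProduct.map counit LinearMap.id) (comul 1 p (cst k (one_mul p).symm c))) = c
  comul_counit' : ∀ (p : G) (c : H p),
    (TensorProduct.rid k (H p))
      ((TensorProduct.map LinearMap.id counit) (comul p 1 (cst k (mul_one p).symm c))) = c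
  comul_mul : ∀ (p q : G) (a b : H (p * q)),
    comul p q (mul (p * q) a b)
      = TensorProduct.map₂ (mul p) (mul q) (comul p q a) (comul p q b)
  comul_one : ∀ p q : G, comul p q (one (p * q)) = (one p) ⊗ₜ[k] (one q)
  counit_mul : ∀ a b : H (1 : G), counit (mul 1 a b) = counit a * counit b
  counit_one : counit (one 1) = 1
  antipode_left : ∀ (p : G) (h : H (1 : G)),
    TensorProduct.lift (mul p)
      ((TensorProduct.map ((cst k (inv_inv p)).comp (antipode p⁻¹)) LinearMap.id)
        (comul p⁻¹ p (cst k (show (1 : G) = p⁻¹ * p by group) h)))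
    = counit h • one p
  antipode_right : ∀ (p : G) (h : H (1 : G)),
    TensorProduct.lift (mul p)
      ((TensorProduct.map LinearMap.id ((cst k (inv_inv p)).comp (antipode p⁻¹)))
        (comul p p⁻¹ (cst k (show (1 : G) = p * p⁻¹ by group) h)))
    = counit h • one p

/-- An automorphism of a Hopf group-coalgebra. -/
structure HopfGCAut {k : Type*} [Field k] {G : Type*} [Group G] {H : G → Type*}
    [∀ p, AddCommGroup (H p)] [∀ p, Module k (H p)] (D : HopfGC k G H) where
  α : ∀ p : G, H p ≃ₗ[k] H p
  map_mul : ∀ (p : G) (a b : H p), α p (D.mul p a b) = D.mul p (α p a) (α p b)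
  map_one : ∀ p : G, α p (D.one p) = D.one p
  map_comul : ∀ (p q : G) (c : H (p * q)),
    TensorProduct.map (α p).toLinearMap (α q).toLinearMap (D.comul p q c)
      = D.comul p q (α (p * q) c)
  map_counit : ∀ c : H (1 : G), D.counit (α 1 c) = D.counit c
  map_antipode : ∀ (p : G) (h : H p), D.antipode p (α p h) = α p⁻¹ (D.antipode p h)

/-- The axioms of a group-cograded monoidal Hom-Hopf algebra, for given structure data. -/
structure IsGCHH (k : Type*) [Field k] {G : Type*} [Group G] {H : G → Type*}
    [∀ p, AddCommGroup (H p)] [∀ p, Module k (H p)]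
    (mul : ∀ p : G, H p →ₗ[k] H p →ₗ[k] H p) (one : ∀ p : G, H p)
    (comul : ∀ p q : G, H (p * q) →ₗ[k] H p ⊗[k] H q) (counit : H (1 : G) →ₗ[k] k)
    (antipode : ∀ p : G, H p →ₗ[k] H p⁻¹) (α : ∀ p : G, H p ≃ₗ[k] H p) : Prop where
  hom_assoc : ∀ (p : G) (a b c : H p), mul p (α p a) (mul p b c) = mul p (mul p a b) (α p c)
  one_mul' : ∀ (p : G) (a : H p), mul p (one p) a = α p a
  mul_one' : ∀ (p : G) (a : H p), mul p a (one p) = α p a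
  α_mul : ∀ (p : G) (a b : H p), α p (mul p a b) = mul p (α p a) (α p b)
  α_one : ∀ p : G, α p (one p) = one p
  hcoassoc : ∀ p q r : G,
    (TensorProduct.map (α p).symm.toLinearMap (comul q r)).comp
      ((comul p (q * r)).comp (cst k (mul_assoc p q r)))
    = (TensorProduct.assoc k (H p) (H q) (H r)).toLinearMap.comp
        ((TensorProduct.map (comul p q) (α r).symm.toLinearMap).comp (comul (p * q) r))
  counit_comul' : ∀ (p : G) (c : H p),
    (TensorProduct.lid k (H p))
      ((TensorProduct.map counit LinearMap.id) (comul 1 p (cst k (one_mul p).symm c)))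
    = (α p).symm c
  comul_counit' : ∀ (p : G) (c : H p),
    (TensorProduct.rid k (H p))
      ((TensorProduct.map LinearMap.id counit) (comul p 1 (cst k (mul_one p).symm c)))
    = (α p).symm c
  comul_αinv : ∀ (p q : G) (c : H (p * q)),
    comul p q ((α (p * q)).symm c)
      = TensorProduct.map (α p).symm.toLinearMap (α q).symm.toLinearMap (comul p q c)
  counit_αinv : ∀ c : H (1 : G), counit ((α 1).symm c) = counit c
  comul_mul : ∀ (p q : G) (a b : H (p * q)),
    comul p q (mul (p * q) a b)
      = TensorProduct.map₂ (mul p) (mul q) (comul p q a) (comul p q b)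
  comul_one : ∀ p q : G, comul p q (one (p * q)) = (one p) ⊗ₜ[k] (one q)
  counit_mul : ∀ a b : H (1 : G), counit (mul 1 a b) = counit a * counit b
  counit_one : counit (one 1) = 1
  antipode_α : ∀ (p : G) (h : H p), antipode p (α p h) = (α p⁻¹) (antipode p h)
  antipode_left : ∀ (p : G) (h : H (1 : G)),
    TensorProduct.lift (mul p)
      ((TensorProduct.map ((cst k (inv_inv p)).comp (antipode p⁻¹)) LinearMap.id)
        (comul p⁻¹ p (cst k (show (1 : G) = p⁻¹ * p by group) h)))
    = counit h • one p
  antipode_right : ∀ (p : G) (h : H (1 : G)),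
    TensorProduct.lift (mul p)
      ((TensorProduct.map LinearMap.id ((cst k (inv_inv p)).comp (antipode p⁻¹)))
        (comul p p⁻¹ (cst k (show (1 : G) = p * p⁻¹ by group) h)))
    = counit h • one p

/-- The axioms of a crossing on a group-cograded (monoidal Hom-)Hopf algebra. -/
structure IsCrossing (k : Type*) [Field k] {G : Type*} [Group G] {H : G → Type*}
    [∀ p, AddCommGroup (H p)] [∀ p, Module k (H p)]
    (mul : ∀ p : G, H p →ₗ[k] H p →ₗ[k] H p) (one : ∀ p : G, H p)
    (comul : ∀ p q : G, H (p * q) →ₗ[k] H p ⊗[k] H q) (counit : H (1 : G) →ₗ[k] k)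
    (α : ∀ p : G, H p ≃ₗ[k] H p)
    (π : ∀ q p : G, H p ≃ₗ[k] H (q * p * q⁻¹)) : Prop where
  π_mul : ∀ (q p : G) (a b : H p),
    π q p (mul p a b) = mul (q * p * q⁻¹) (π q p a) (π q p b)
  π_one : ∀ q p : G, π q p (one p) = one (q * p * q⁻¹)
  π_α : ∀ (q p : G) (a : H p), π q p (α p a) = α (q * p * q⁻¹) (π q p a)
  π_comul : ∀ (q a b : G) (c : H (a * b)),
    TensorProduct.map (π q a).toLinearMap (π q b).toLinearMap (comul a b c)
      = comul (q * a * q⁻¹) (q * b * q⁻¹)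
          (cst k (show q * (a * b) * q⁻¹ = (q * a * q⁻¹) * (q * b * q⁻¹) by group) (π q (a * b) c))
  π_counit : ∀ (q : G) (c : H (1 : G)),
    counit (cst k (show q * (1 : G) * q⁻¹ = 1 by group) (π q 1 c)) = counit c
  π_mult : ∀ (a b p : G) (c : H p),
    cst k (show (a * b) * p * (a * b)⁻¹ = a * (b * p * b⁻¹) * a⁻¹ by group) (π (a * b) p c)
      = π a (b * p * b⁻¹) (π b p c)

/-- A (classical) Hopf `T`-coalgebra: a Hopf group-coalgebra with a crossing. -/
structure HopfTC (k : Type*) [Field k] (G : Type*) [Group G] (H : G → Type*)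
    [∀ p, AddCommGroup (H p)] [∀ p, Module k (H p)] extends HopfGC k G H where
  π : ∀ q p : G, H p ≃ₗ[k] H (q * p * q⁻¹)
  π_mul : ∀ (q p : G) (a b : H p),
    π q p (mul p a b) = mul (q * p * q⁻¹) (π q p a) (π q p b)
  π_one : ∀ q p : G, π q p (one p) = one (q * p * q⁻¹)
  π_comul : ∀ (q a b : G) (c : H (a * b)),
    TensorProduct.map (π q a).toLinearMap (π q b).toLinearMap (comul a b c)
      = comul (q * a * q⁻¹) (q * b * q⁻¹)
          (cst k (show q * (a * b) * q⁻¹ = (q * a * q⁻¹) * (q * b * q⁻¹) by group) (π q (a * b) c))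
  π_counit : ∀ (q : G) (c : H (1 : G)),
    counit (cst k (show q * (1 : G) * q⁻¹ = 1 by group) (π q 1 c)) = counit c
  π_antipode : ∀ (q p : G) (h : H p),
    antipode (q * p * q⁻¹) (π q p h)
      = cst k (show q * p⁻¹ * q⁻¹ = (q * p * q⁻¹)⁻¹ by group) (π q p⁻¹ (antipode p h))
  π_mult : ∀ (a b p : G) (c : H p),
    cst k (show (a * b) * p * (a * b)⁻¹ = a * (b * p * b⁻¹) * a⁻¹ by group) (π (a * b) p c)
      = π a (b * p * b⁻¹) (π b p c)

/-- A group-cograded monoidal Hom-Hopf algebra (bundled data). -/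
structure GCHH (k : Type*) [Field k] (G : Type*) [Group G] (H : G → Type*)
    [∀ p, AddCommGroup (H p)] [∀ p, Module k (H p)] where
  mul : ∀ p : G, H p →ₗ[k] H p →ₗ[k] H p
  one : ∀ p : G, H p
  comul : ∀ p q : G, H (p * q) →ₗ[k] H p ⊗[k] H q
  counit : H (1 : G) →ₗ[k] k
  antipode : ∀ p : G, H p →ₗ[k] H p⁻¹
  α : ∀ p : G, H p ≃ₗ[k] H p
  ax : IsGCHH k mul one comul counit antipode α

/-- A monoidal Hom-Hopf `T`-coalgebra with bijective antipode (bundled data). -/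
structure HomTC (k : Type*) [Field k] (G : Type*) [Group G] (H : G → Type*)
    [∀ p, AddCommGroup (H p)] [∀ p, Module k (H p)] where
  mul : ∀ p : G, H p →ₗ[k] H p →ₗ[k] H p
  one : ∀ p : G, H p
  comul : ∀ p q : G, H (p * q) →ₗ[k] H p ⊗[k] H q
  counit : H (1 : G) →ₗ[k] k
  antipode : ∀ p : G, H p ≃ₗ[k] H p⁻¹
  α : ∀ p : G, H p ≃ₗ[k] H p
  π : ∀ q p : G, H p ≃ₗ[k] H (q * p * q⁻¹)
  ax : IsGCHH k mul one comul counit (fun p => (antipode p).toLinearMap) α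
  cax : IsCrossing k mul one comul counit α π

section YD

variable {k : Type*} [Field k] {G : Type*} [Group G] {H : G → Type*}
  [∀ p, AddCommGroup (H p)] [∀ p, Module k (H p)]

variable (k)

/-- The Yetter-Drinfeld compatibility condition (3) of Definition 4.1. -/
def YDcompat (T : HomTC k G H) (p : G) {M : Type*} [AddCommGroup M] [Module k M]
    (μ : M ≃ₗ[k] M) (act : H p →ₗ[k] M →ₗ[k] M)
    (ρ : ∀ r : G, M →ₗ[k] M ⊗[k] H r) : Prop :=
  ∀ r : G,
    (TensorProduct.map (TensorProduct.lift act) (TensorProduct.lift (T.mul r))).comp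
      ((TensorProduct.tensorTensorTensorComm k (H p) (H r) M (H r)).toLinearMap.comp
        (TensorProduct.map (T.comul p r) (ρ r)))
    =
    (TensorProduct.map μ.toLinearMap (TensorProduct.lift (T.mul r))).comp
      ((TensorProduct.assoc k M (H r) (H r)).toLinearMap.comp
        (((TensorProduct.comm k (H r) (M ⊗[k] H r)).toLinearMap).comp
          ((TensorProduct.map
              ((cst k (show p⁻¹ * (p * r * p⁻¹) * p⁻¹⁻¹ = r by group)).comp
                (T.π p⁻¹ (p * r * p⁻¹)).toLinearMap)
              ((ρ r).comp (TensorProduct.lift act))).comp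
            ((TensorProduct.assoc k (H (p * r * p⁻¹)) (H p) M).toLinearMap.comp
              (TensorProduct.map
                ((T.comul (p * r * p⁻¹) p).comp
                  (cst k (show p * r = (p * r * p⁻¹) * p by group)))
                μ.symm.toLinearMap)))))

/-- The axioms of a (left-right) `p`-Yetter-Drinfeld module over a monoidal Hom-Hopf
`T`-coalgebra. -/
structure IsYD (T : HomTC k G H) (p : G) {M : Type*} [AddCommGroup M] [Module k M]
    (μ : M ≃ₗ[k] M) (act : H p →ₗ[k] M →ₗ[k] M)
    (ρ : ∀ r : G, M →ₗ[k] M ⊗[k] H r) : Prop where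
  act_act : ∀ (a b : H p) (m : M), act (T.α p a) (act b m) = act (T.mul p a b) (μ m)
  act_one : ∀ m : M, act (T.one p) m = μ m
  μ_act : ∀ (a : H p) (m : M), μ (act a m) = act (T.α p a) (μ m)
  ρ_coassoc : ∀ a b : G,
    (TensorProduct.map μ.symm.toLinearMap (T.comul a b)).comp (ρ (a * b))
    = (TensorProduct.assoc k M (H a) (H b)).toLinearMap.comp
        ((TensorProduct.map (ρ a) (T.α b).symm.toLinearMap).comp (ρ b))
  ρ_counit : ∀ m : M,
    (TensorProduct.rid k M) ((TensorProduct.map LinearMap.id T.counit) (ρ 1 m)) = μ.symm m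
  ρ_μ : ∀ r : G,
    (ρ r).comp μ.toLinearMap
      = (TensorProduct.map μ.toLinearMap (T.α r).toLinearMap).comp (ρ r)
  compat : YDcompat k T p μ act ρ

/-- The action of `H (a*b)` on a tensor product of an `H a`-module and an `H b`-module. -/
def tAct (T : HomTC k G H) (a b : G) {M N : Type*} [AddCommGroup M] [Module k M]
    [AddCommGroup N] [Module k N]
    (actM : H a →ₗ[k] M →ₗ[k] M) (actN : H b →ₗ[k] N →ₗ[k] N) :
    H (a * b) →ₗ[k] (M ⊗[k] N) →ₗ[k] (M ⊗[k] N) :=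
  (TensorProduct.map₂ actM actN).comp (T.comul a b)

/-- The coaction on the tensor product `M ⊗ N`, where `N` has degree `b`:
`ρ r (m ⊗ n) = m₍₀₎ ⊗ n₍₀₎ ⊗ n₍₁,r₎ ⬝ π_{b⁻¹}(m₍₁,brb⁻¹₎)`. -/
def tCoact (T : HomTC k G H) (b : G) {M N : Type*} [AddCommGroup M] [Module k M]
    [AddCommGroup N] [Module k N]
    (ρM : ∀ r : G, M →ₗ[k] M ⊗[k] H r) (ρN : ∀ r : G, N →ₗ[k] N ⊗[k] H r) (r : G) :
    (M ⊗[k] N) →ₗ[k] (M ⊗[k] N) ⊗[k] H r :=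
  (TensorProduct.map LinearMap.id
      (TensorProduct.lift (((T.mul r).flip).comp
        ((cst k (show b⁻¹ * (b * r * b⁻¹) * b⁻¹⁻¹ = r by group)).comp
          (T.π b⁻¹ (b * r * b⁻¹)).toLinearMap)))).comp
    ((TensorProduct.tensorTensorTensorComm k M (H (b * r * b⁻¹)) N (H r)).toLinearMap.comp
      (TensorProduct.map (ρM (b * r * b⁻¹)) (ρN r)))

/-- The conjugate action on `ᵠM`: `h ⇀ m = π_{s⁻¹}(h) ⬝ m`. -/
def cAct (T : HomTC k G H) (s p : G) {M : Type*} [AddCommGroup M] [Module k M]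
    (act : H p →ₗ[k] M →ₗ[k] M) : H (s * p * s⁻¹) →ₗ[k] M →ₗ[k] M :=
  act.comp ((cst k (show s⁻¹ * (s * p * s⁻¹) * s⁻¹⁻¹ = p by group)).comp
    (T.π s⁻¹ (s * p * s⁻¹)).toLinearMap)

/-- The conjugate coaction on `ˢM`: `ρ r m = m₍₀₎ ⊗ π_s (m₍₁,s⁻¹rs₎)`. -/
def cCoact (T : HomTC k G H) (s : G) {M : Type*} [AddCommGroup M] [Module k M]
    (ρ : ∀ r : G, M →ₗ[k] M ⊗[k] H r) (r : G) : M →ₗ[k] M ⊗[k] H r :=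
  (TensorProduct.map LinearMap.id
      ((cst k (show s * (s⁻¹ * r * s) * s⁻¹ = r by group)).comp
        (T.π s (s⁻¹ * r * s)).toLinearMap)).comp
    (ρ (s⁻¹ * r * s))

/-- The Hom-associator `(A ⊗ B) ⊗ C ≃ A ⊗ (B ⊗ C)`, `(a ⊗ b) ⊗ c ↦ φA a ⊗ (b ⊗ φC⁻¹ c)`. -/
def homAssoc {A B C : Type*} [AddCommGroup A] [Module k A] [AddCommGroup B] [Module k B]
    [AddCommGroup C] [Module k C] (φA : A ≃ₗ[k] A) (φC : C ≃ₗ[k] C) :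
    (A ⊗[k] B) ⊗[k] C ≃ₗ[k] A ⊗[k] (B ⊗[k] C) :=
  (TensorProduct.assoc k A B C).trans
    (TensorProduct.congr φA (TensorProduct.congr (LinearEquiv.refl k B) φC.symm))

/-- The braiding `c_{M,W} : M ⊗ W → ᴹW ⊗ M`,
`m ⊗ w ↦ (S_{w⁻¹}(m₍₁,w⁻¹₎) ⬝ φW⁻¹ w) ⊗ μ m₍₀₎`, where `W` has degree `w`. -/
def braid (T : HomTC k G H) (w : G) {M W : Type*} [AddCommGroup M] [Module k M]
    [AddCommGroup W] [Module k W] (μ : M ≃ₗ[k] M) (ρM : ∀ r : G, M →ₗ[k] M ⊗[k] H r)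
    (actW : H w →ₗ[k] W →ₗ[k] W) (φW : W ≃ₗ[k] W) : (M ⊗[k] W) →ₗ[k] (W ⊗[k] M) :=
  (TensorProduct.comm k M W).toLinearMap.comp
    ((TensorProduct.map μ.toLinearMap
        (TensorProduct.lift (actW.comp
          ((cst k (inv_inv w)).comp (T.antipode w⁻¹).toLinearMap)))).comp
      ((TensorProduct.assoc k M (H w⁻¹) W).toLinearMap.comp
        (TensorProduct.map (ρM w⁻¹) φW.symm.toLinearMap)))

end YD

/-- The axioms of a monoidal Hom-Hopf algebra on a single space. -/
structure IsMonHomHopf (k : Type*) [Field k] (A : Type*) [AddCommGroup A] [Module k A]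
    (mul : A →ₗ[k] A →ₗ[k] A) (one : A) (comul : A →ₗ[k] A ⊗[k] A) (counit : A →ₗ[k] k)
    (S : A →ₗ[k] A) (α : A ≃ₗ[k] A) : Prop where
  hom_assoc : ∀ a b c : A, mul (α a) (mul b c) = mul (mul a b) (α c)
  one_mul' : ∀ a : A, mul one a = α a
  mul_one' : ∀ a : A, mul a one = α a
  α_mul : ∀ a b : A, α (mul a b) = mul (α a) (α b)
  α_one : α one = one
  hcoassoc :
    (TensorProduct.map α.symm.toLinearMap comul).comp comul
    = (TensorProduct.assoc k A A A).toLinearMap.comp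
        ((TensorProduct.map comul α.symm.toLinearMap).comp comul)
  counit_comul' : ∀ a : A,
    (TensorProduct.lid k A) ((TensorProduct.map counit LinearMap.id) (comul a)) = α.symm a
  comul_counit' : ∀ a : A,
    (TensorProduct.rid k A) ((TensorProduct.map LinearMap.id counit) (comul a)) = α.symm a
  comul_αinv : ∀ a : A,
    comul (α.symm a) = TensorProduct.map α.symm.toLinearMap α.symm.toLinearMap (comul a)
  counit_αinv : ∀ a : A, counit (α.symm a) = counit a
  comul_mul : ∀ a b : A, comul (mul a b) = TensorProduct.map₂ mul mul (comul a) (comul b)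
  comul_one : comul one = one ⊗ₜ[k] one
  counit_mul : ∀ a b : A, counit (mul a b) = counit a * counit b
  counit_one : counit one = 1
  antipode_α : ∀ a : A, S (α a) = α (S a)
  antipode_left : ∀ a : A,
    TensorProduct.lift mul ((TensorProduct.map S LinearMap.id) (comul a)) = counit a • one
  antipode_right : ∀ a : A,
    TensorProduct.lift mul ((TensorProduct.map LinearMap.id S) (comul a)) = counit a • one

/-- Uniqueness of convolution inverses, for the components of a group-graded coalgebra: a left
inverse and a right inverse of the same map `m` agree. -/
theorem convolution_left_inv_eq_right_inv {k C₁ C D A : Type*} [Field k]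
    [AddCommGroup C₁] [Module k C₁] [AddCommGroup C] [Module k C] [AddCommGroup D] [Module k D]
    [AddCommGroup A] [Module k A]
    (Δl : C →ₗ[k] C₁ ⊗[k] C) (Δr : C →ₗ[k] C ⊗[k] C₁)
    (Δ : C₁ →ₗ[k] C ⊗[k] D) (Δ' : C₁ →ₗ[k] D ⊗[k] C) (ε : C₁ →ₗ[k] k)
    (coassoc : ∀ c, TensorProduct.assoc k C D C (TensorProduct.map Δ LinearMap.id (Δl c))
      = TensorProduct.map LinearMap.id Δ' (Δr c))
    (counit_l : ∀ c, TensorProduct.lid k C (TensorProduct.map ε LinearMap.id (Δl c)) = c)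
    (counit_r : ∀ c, TensorProduct.rid k C (TensorProduct.map LinearMap.id ε (Δr c)) = c)
    (mul : A →ₗ[k] A →ₗ[k] A) (one : A)
    (mul_assoc : ∀ a b c, mul (mul a b) c = mul a (mul b c))
    (one_mul : ∀ a, mul one a = a) (mul_one : ∀ a, mul a one = a)
    (f g : C →ₗ[k] A) (m : D →ₗ[k] A)
    (hfm : ∀ c, TensorProduct.lift mul (TensorProduct.map f m (Δ c)) = ε c • one)
    (hmg : ∀ c, TensorProduct.lift mul (TensorProduct.map m g (Δ' c)) = ε c • one) :
    f = g := by
  have key : ∀ w : (C ⊗[k] D) ⊗[k] C,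
      TensorProduct.lift mul (TensorProduct.map f
          ((TensorProduct.lift mul).comp (TensorProduct.map m g)) (TensorProduct.assoc k C D C w))
      = TensorProduct.lift mul (TensorProduct.map
          ((TensorProduct.lift mul).comp (TensorProduct.map f m)) g w) := by
    intro w
    induction w using TensorProduct.induction_on with
    | zero => simp
    | add x y hx hy => simp only [map_add, hx, hy]
    | tmul u c =>
      induction u using TensorProduct.induction_on with
      | zero => simp
      | add x y hx hy => simp only [map_add, TensorProduct.add_tmul, hx, hy]
      | tmul a b => simp [mul_assoc]
  have hr : ∀ u : C ⊗[k] C₁,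
      TensorProduct.lift mul (TensorProduct.map f
          ((TensorProduct.lift mul).comp (TensorProduct.map m g))
          (TensorProduct.map LinearMap.id Δ' u))
      = f (TensorProduct.rid k C (TensorProduct.map LinearMap.id ε u)) := by
    intro u
    induction u using TensorProduct.induction_on with
    | zero => simp
    | add x y hx hy => simp only [map_add, hx, hy]
    | tmul a b => simp [hmg, mul_one]
  have hl : ∀ u : C₁ ⊗[k] C,
      TensorProduct.lift mul (TensorProduct.map
          ((TensorProduct.lift mul).comp (TensorProduct.map f m)) g
          (TensorProduct.map Δ LinearMap.id u))
      = g (TensorProduct.lid k C (TensorProduct.map ε LinearMap.id u)) := by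
    intro u
    induction u using TensorProduct.induction_on with
    | zero => simp
    | add x y hx hy => simp only [map_add, hx, hy]
    | tmul a b => simp [hfm, one_mul]
  ext c
  rw [← counit_r c, ← hr, ← coassoc, key, hl, counit_l, counit_r]

/-- Componentwise comultiplication on a tensor product of two coalgebra components. -/
def tensorComul {k A B C : Type*} [Field k] [AddCommGroup A] [Module k A] [AddCommGroup B]
    [Module k B] [AddCommGroup C] [Module k C] (Δ : A →ₗ[k] B ⊗[k] C) :
    A ⊗[k] A →ₗ[k] (B ⊗[k] B) ⊗[k] (C ⊗[k] C) :=
  (TensorProduct.tensorTensorTensorComm k B C B C).toLinearMap.comp (TensorProduct.map Δ Δ)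

section TensorComul

variable {k C₁ C D : Type*} [Field k] [AddCommGroup C₁] [Module k C₁]
  [AddCommGroup C] [Module k C] [AddCommGroup D] [Module k D]

theorem tensorComul_coassoc
    (Δl : C →ₗ[k] C₁ ⊗[k] C) (Δr : C →ₗ[k] C ⊗[k] C₁)
    (Δ : C₁ →ₗ[k] C ⊗[k] D) (Δ' : C₁ →ₗ[k] D ⊗[k] C)
    (coassoc : ∀ c, TensorProduct.assoc k C D C (TensorProduct.map Δ LinearMap.id (Δl c))
      = TensorProduct.map LinearMap.id Δ' (Δr c)) (c : C ⊗[k] C) :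
    TensorProduct.assoc k _ _ _ (TensorProduct.map (tensorComul Δ) LinearMap.id
        (tensorComul Δl c))
      = TensorProduct.map LinearMap.id (tensorComul Δ') (tensorComul Δr c) := by
  let sh : (C ⊗[k] (D ⊗[k] C)) ⊗[k] (C ⊗[k] (D ⊗[k] C)) →ₗ[k]
      (C ⊗[k] C) ⊗[k] ((D ⊗[k] D) ⊗[k] (C ⊗[k] C)) :=
    (TensorProduct.map LinearMap.id
      (TensorProduct.tensorTensorTensorComm k D C D C).toLinearMap).comp
      (TensorProduct.tensorTensorTensorComm k C (D ⊗[k] C) C (D ⊗[k] C)).toLinearMap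
  have hl : ∀ u v : C₁ ⊗[k] C,
      TensorProduct.assoc k _ _ _ (TensorProduct.map (tensorComul Δ) LinearMap.id
        (TensorProduct.tensorTensorTensorComm k C₁ C C₁ C (u ⊗ₜ v)))
      = sh (TensorProduct.assoc k C D C (TensorProduct.map Δ LinearMap.id u) ⊗ₜ
          TensorProduct.assoc k C D C (TensorProduct.map Δ LinearMap.id v)) := by
    intro u v
    induction u using TensorProduct.induction_on with
    | zero => simp
    | add x y hx hy => simp only [map_add, TensorProduct.add_tmul, hx, hy]
    | tmul a b =>
      induction v using TensorProduct.induction_on with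
      | zero => simp
      | add x y hx hy => simp only [map_add, TensorProduct.tmul_add, hx, hy]
      | tmul a' b' =>
        simp only [TensorProduct.tensorTensorTensorComm_tmul, TensorProduct.map_tmul,
          tensorComul, LinearMap.comp_apply, LinearEquiv.coe_coe, LinearMap.id_apply]
        generalize Δ a = w
        generalize Δ a' = w'
        induction w using TensorProduct.induction_on with
        | zero => simp
        | add x y hx hy => simp only [map_add, TensorProduct.add_tmul, hx, hy]
        | tmul =>
          induction w' using TensorProduct.induction_on with
          | zero => simp
          | add x y hx hy =>
            simp only [map_add, TensorProduct.add_tmul, TensorProduct.tmul_add, hx, hy]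
          | tmul => simp [sh]
  have hr : ∀ u v : C ⊗[k] C₁,
      TensorProduct.map LinearMap.id (tensorComul Δ')
        (TensorProduct.tensorTensorTensorComm k C C₁ C C₁ (u ⊗ₜ v))
      = sh (TensorProduct.map LinearMap.id Δ' u ⊗ₜ TensorProduct.map LinearMap.id Δ' v) := by
    intro u v
    induction u using TensorProduct.induction_on with
    | zero => simp
    | add x y hx hy => simp only [map_add, TensorProduct.add_tmul, hx, hy]
    | tmul a b =>
      induction v using TensorProduct.induction_on with
      | zero => simp
      | add x y hx hy => simp only [map_add, TensorProduct.tmul_add, hx, hy]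
      | tmul a' b' => simp [sh, tensorComul]
  induction c using TensorProduct.induction_on with
  | zero => simp
  | add x y hx hy => simp only [map_add, hx, hy]
  | tmul a b =>
    have := hl (Δl a) (Δl b)
    rw [coassoc, coassoc, ← hr] at this
    simpa [tensorComul] using this

theorem tensorComul_counit_left (Δl : C →ₗ[k] C₁ ⊗[k] C) (ε : C₁ →ₗ[k] k)
    (counit_l : ∀ c, TensorProduct.lid k C (TensorProduct.map ε LinearMap.id (Δl c)) = c)
    (c : C ⊗[k] C) :
    TensorProduct.lid k _ (TensorProduct.map
      ((TensorProduct.lid k k).toLinearMap.comp (TensorProduct.map ε ε)) LinearMap.id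
      (tensorComul Δl c)) = c := by
  have hl : ∀ u v : C₁ ⊗[k] C,
      TensorProduct.lid k _ (TensorProduct.map
        ((TensorProduct.lid k k).toLinearMap.comp (TensorProduct.map ε ε)) LinearMap.id
        (TensorProduct.tensorTensorTensorComm k C₁ C C₁ C (u ⊗ₜ v)))
      = TensorProduct.lid k C (TensorProduct.map ε LinearMap.id u) ⊗ₜ
          TensorProduct.lid k C (TensorProduct.map ε LinearMap.id v) := by
    intro u v
    induction u using TensorProduct.induction_on with
    | zero => simp
    | add x y hx hy => simp only [map_add, TensorProduct.add_tmul, hx, hy]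
    | tmul a b =>
      induction v using TensorProduct.induction_on with
      | zero => simp
      | add x y hx hy => simp only [map_add, TensorProduct.tmul_add, hx, hy]
      | tmul a' b' =>
        simp only [TensorProduct.tensorTensorTensorComm_tmul, TensorProduct.map_tmul,
          LinearMap.comp_apply, LinearEquiv.coe_coe, TensorProduct.lid_tmul, LinearMap.id_apply,
          TensorProduct.smul_tmul',
          TensorProduct.tmul_smul, smul_eq_mul, mul_smul]
        rw [smul_comm]
  induction c using TensorProduct.induction_on with
  | zero => simp
  | add x y hx hy => simp only [map_add, hx, hy]
  | tmul a b => simpa [tensorComul, counit_l] using hl (Δl a) (Δl b)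

theorem tensorComul_counit_right (Δr : C →ₗ[k] C ⊗[k] C₁) (ε : C₁ →ₗ[k] k)
    (counit_r : ∀ c, TensorProduct.rid k C (TensorProduct.map LinearMap.id ε (Δr c)) = c)
    (c : C ⊗[k] C) :
    TensorProduct.rid k _ (TensorProduct.map LinearMap.id
      ((TensorProduct.lid k k).toLinearMap.comp (TensorProduct.map ε ε))
      (tensorComul Δr c)) = c := by
  have hr : ∀ u v : C ⊗[k] C₁,
      TensorProduct.rid k _ (TensorProduct.map LinearMap.id
        ((TensorProduct.lid k k).toLinearMap.comp (TensorProduct.map ε ε))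
        (TensorProduct.tensorTensorTensorComm k C C₁ C C₁ (u ⊗ₜ v)))
      = TensorProduct.rid k C (TensorProduct.map LinearMap.id ε u) ⊗ₜ
          TensorProduct.rid k C (TensorProduct.map LinearMap.id ε v) := by
    intro u v
    induction u using TensorProduct.induction_on with
    | zero => simp
    | add x y hx hy => simp only [map_add, TensorProduct.add_tmul, hx, hy]
    | tmul a b =>
      induction v using TensorProduct.induction_on with
      | zero => simp
      | add x y hx hy => simp only [map_add, TensorProduct.tmul_add, hx, hy]
      | tmul a' b' =>
        simp only [TensorProduct.tensorTensorTensorComm_tmul, TensorProduct.map_tmul,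
          LinearMap.comp_apply, LinearEquiv.coe_coe, TensorProduct.lid_tmul,
          TensorProduct.rid_tmul, LinearMap.id_apply,
          TensorProduct.smul_tmul',
          TensorProduct.tmul_smul, smul_eq_mul, mul_smul]
        rw [smul_comm]
  induction c using TensorProduct.induction_on with
  | zero => simp
  | add x y hx hy => simp only [map_add, hx, hy]
  | tmul a b => simpa [tensorComul, counit_r] using hr (Δr a) (Δr b)

end TensorComul

theorem map₂_eq_map_lift {k A B : Type*} [Field k] [AddCommGroup A] [Module k A]
    [AddCommGroup B] [Module k B] (f : A →ₗ[k] A →ₗ[k] A) (g : B →ₗ[k] B →ₗ[k] B)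
    (u v : A ⊗[k] B) :
    TensorProduct.map₂ f g u v = TensorProduct.map (TensorProduct.lift f) (TensorProduct.lift g)
      (TensorProduct.tensorTensorTensorComm k A B A B (u ⊗ₜ v)) := by
  induction u using TensorProduct.induction_on with
  | zero => simp
  | add x y hx hy => simp only [map_add, LinearMap.add_apply, TensorProduct.add_tmul, hx, hy]
  | tmul =>
    induction v using TensorProduct.induction_on with
    | zero => simp
    | add x y hx hy => simp only [map_add, TensorProduct.tmul_add, hx, hy]
    | tmul => simp

section Transport

variable {k : Type*} [Field k] {G : Type*} {H : G → Type*}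
  [∀ p, AddCommGroup (H p)] [∀ p, Module k (H p)]

@[simp] theorem cst_self {a : G} (h : a = a) (x : H a) : cst k h x = x := rfl

@[simp] theorem cst_cst {a b c : G} (h : a = b) (h' : b = c) (x : H a) :
    cst k h' (cst k h x) = cst k (h.trans h') x := by
  subst h h'; rfl

end Transport

namespace HomTC

variable {k : Type*} [Field k] {G : Type*} [Group G] {H : G → Type*}
  [∀ p, AddCommGroup (H p)] [∀ p, Module k (H p)] (T : HomTC k G H)

theorem α_symm_cst {a b : G} (h : a = b) (x : H a) :
    (T.α b).symm (cst k h x) = cst k h ((T.α a).symm x) := by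
  subst h; rfl

theorem antipode_α (p : G) (x : H p) : T.antipode p (T.α p x) = T.α p⁻¹ (T.antipode p x) :=
  T.ax.antipode_α p x

theorem α_symm_mul (p : G) (x y : H p) :
    (T.α p).symm (T.mul p x y) = T.mul p ((T.α p).symm x) ((T.α p).symm y) := by
  rw [LinearEquiv.symm_apply_eq, T.ax.α_mul]; simp

theorem antipode_α_symm (p : G) (x : H p) :
    T.antipode p ((T.α p).symm x) = (T.α p⁻¹).symm (T.antipode p x) := by
  rw [LinearEquiv.eq_symm_apply, ← antipode_α]; simp

theorem π_α_symm (q p : G) (x : H p) :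
    T.π q p ((T.α p).symm x) = (T.α _).symm (T.π q p x) := by
  rw [LinearEquiv.eq_symm_apply, ← T.cax.π_α]; simp

theorem comul_α (p q : G) (c : H (p * q)) :
    T.comul p q (T.α (p * q) c)
      = TensorProduct.map (T.α p).toLinearMap (T.α q).toLinearMap (T.comul p q c) := by
  have h := T.ax.comul_αinv p q (T.α (p * q) c)
  rw [LinearEquiv.symm_apply_apply] at h
  rw [h]
  generalize T.comul p q (T.α (p * q) c) = w
  induction w using TensorProduct.induction_on with
  | zero => simp
  | add x y hx hy => simp only [map_add, ← hx, ← hy]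
  | tmul => simp

/-- The associative multiplication `α⁻¹ ∘ mul` obtained by untwisting. -/
def umul (p : G) : H p →ₗ[k] H p →ₗ[k] H p :=
  (T.mul p).compr₂ (T.α p).symm.toLinearMap

@[simp] theorem umul_apply (p : G) (x y : H p) : T.umul p x y = (T.α p).symm (T.mul p x y) := rfl

/-- The coassociative comultiplication `(α ⊗ α) ∘ comul` obtained by untwisting, with the degree
of the source free. -/
def ucomul {a b c : G} (h : a * b = c) : H c →ₗ[k] H a ⊗[k] H b :=
  (TensorProduct.map (T.α a).toLinearMap (T.α b).toLinearMap).comp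
    ((T.comul a b).comp (cst k h.symm))

/-- The antipode with the degree of its target free. -/
def santipode {a b : G} (h : a⁻¹ = b) : H a →ₗ[k] H b :=
  (cst k h).comp (T.antipode a).toLinearMap

/-- The crossing with the degree of its target free. -/
def cross (q : G) {a b : G} (h : q * a * q⁻¹ = b) : H a →ₗ[k] H b :=
  (cst k h).comp (T.π q a).toLinearMap

theorem santipode_cst {a b c : G} (h : a = b) (h' : b⁻¹ = c) (x : H a) :
    T.santipode h' (cst k h x) = T.santipode (by rw [h, h']) x := by
  subst h; rfl

theorem umul_assoc (p : G) (x y z : H p) :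
    T.umul p (T.umul p x y) z = T.umul p x (T.umul p y z) := by
  have h := T.ax.hom_assoc p ((T.α p).symm ((T.α p).symm x)) ((T.α p).symm ((T.α p).symm y))
    ((T.α p).symm ((T.α p).symm z))
  simp only [LinearEquiv.apply_symm_apply] at h
  simp only [umul_apply, α_symm_mul, h]

theorem one_umul (p : G) (x : H p) : T.umul p (T.one p) x = x := by
  simp [T.ax.one_mul']

theorem umul_one (p : G) (x : H p) : T.umul p x (T.one p) = x := by
  simp [T.ax.mul_one']

theorem ucomul_coassoc {a b c ab bc abc : G} (h₁ : a * b = ab) (h₂ : b * c = bc)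
    (h₃ : ab * c = abc) (h₄ : a * bc = abc) (x : H abc) :
    TensorProduct.assoc k _ _ _
        (TensorProduct.map (T.ucomul h₁) LinearMap.id (T.ucomul h₃ x))
      = TensorProduct.map LinearMap.id (T.ucomul h₂) (T.ucomul h₄ x) := by
  subst h₁ h₂ h₃
  have h := LinearMap.congr_fun (T.ax.hcoassoc a b c) x
  let A : ∀ p : G, H p →ₗ[k] H p := fun p => (T.α p).toLinearMap.comp (T.α p).toLinearMap
  have hl : ∀ u : H (a * b) ⊗[k] H c,
      TensorProduct.assoc k _ _ _ (TensorProduct.map (T.ucomul rfl) LinearMap.id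
        (TensorProduct.map (T.α (a * b)).toLinearMap (T.α c).toLinearMap u))
      = TensorProduct.map (A a) (TensorProduct.map (A b) (A c))
        (TensorProduct.assoc k (H a) (H b) (H c)
          (TensorProduct.map (T.comul a b) (T.α c).symm.toLinearMap u)) := by
    intro u
    induction u using TensorProduct.induction_on with
    | zero => simp
    | add x y hx hy => simp only [map_add, hx, hy]
    | tmul y z =>
      simp only [TensorProduct.map_tmul, ucomul, LinearMap.comp_apply, LinearEquiv.coe_coe,
        cst_self, comul_α, LinearMap.id_apply]
      generalize T.comul a b y = w
      induction w using TensorProduct.induction_on with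
      | zero => simp
      | add x y hx hy => simp only [map_add, TensorProduct.add_tmul, hx, hy]
      | tmul => simp [A]
  have hr : ∀ u : H a ⊗[k] H (b * c),
      TensorProduct.map LinearMap.id (T.ucomul rfl)
        (TensorProduct.map (T.α a).toLinearMap (T.α (b * c)).toLinearMap u)
      = TensorProduct.map (A a) (TensorProduct.map (A b) (A c))
          (TensorProduct.map (T.α a).symm.toLinearMap (T.comul b c) u) := by
    intro u
    induction u using TensorProduct.induction_on with
    | zero => simp
    | add x y hx hy => simp only [map_add, hx, hy]
    | tmul y z =>
      simp only [TensorProduct.map_tmul, ucomul, LinearMap.comp_apply, LinearEquiv.coe_coe,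
        cst_self, comul_α, LinearMap.id_apply]
      generalize T.comul b c z = w
      induction w using TensorProduct.induction_on with
      | zero => simp
      | add x y hx hy => simp only [map_add, TensorProduct.tmul_add, hx, hy]
      | tmul => simp [A]
  simp only [LinearMap.comp_apply, LinearEquiv.coe_coe] at h
  have e₁ := hl (T.comul (a * b) c x)
  have e₂ := hr (T.comul a (b * c) (cst k (mul_assoc a b c) x))
  rw [h, ← e₁] at e₂
  exact e₂.symm

theorem ucomul_counit_left {p : G} (h : 1 * p = p) (x : H p) :
    TensorProduct.lid k _ (TensorProduct.map T.counit LinearMap.id (T.ucomul h x)) = x := by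
  have e := T.ax.counit_comul' p x
  have hc : ∀ y, T.counit (T.α 1 y) = T.counit y := fun y => by
    rw [← T.ax.counit_αinv, LinearEquiv.symm_apply_apply]
  rw [LinearEquiv.eq_symm_apply] at e
  conv_rhs => rw [← e]
  simp only [ucomul, LinearMap.comp_apply]
  generalize T.comul 1 p _ = w
  induction w using TensorProduct.induction_on with
  | zero => simp
  | add x y hx hy => simp only [map_add, hx, hy]
  | tmul => simp [hc]

theorem ucomul_counit_right {p : G} (h : p * 1 = p) (x : H p) :
    TensorProduct.rid k _ (TensorProduct.map LinearMap.id T.counit (T.ucomul h x)) = x := by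
  have e := T.ax.comul_counit' p x
  have hc : ∀ y, T.counit (T.α 1 y) = T.counit y := fun y => by
    rw [← T.ax.counit_αinv, LinearEquiv.symm_apply_apply]
  rw [LinearEquiv.eq_symm_apply] at e
  conv_rhs => rw [← e]
  simp only [ucomul, LinearMap.comp_apply]
  generalize T.comul p 1 _ = w
  induction w using TensorProduct.induction_on with
  | zero => simp
  | add x y hx hy => simp only [map_add, hx, hy]
  | tmul => simp [hc]

theorem ucomul_umul {a b c : G} (h : a * b = c) (x y : H c) :
    T.ucomul h (T.umul c x y)
      = TensorProduct.map₂ (T.umul a) (T.umul b) (T.ucomul h x) (T.ucomul h y) := by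
  subst h
  simp only [ucomul, LinearMap.comp_apply, umul_apply, cst_self, T.ax.comul_αinv, T.ax.comul_mul]
  generalize T.comul a b x = u
  generalize T.comul a b y = v
  induction u using TensorProduct.induction_on with
  | zero => simp
  | add x y hx hy => simp only [map_add, LinearMap.add_apply, hx, hy]
  | tmul =>
    induction v using TensorProduct.induction_on with
    | zero => simp
    | add x y hx hy => simp only [map_add, hx, hy]
    | tmul => simp [← T.ax.α_mul]

theorem counit_umul (x y : H (1 : G)) :
    T.counit (T.umul 1 x y) = T.counit x * T.counit y := by
  rw [umul_apply, T.ax.counit_αinv, T.ax.counit_mul]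

theorem santipode_umul_id {a b : G} (h : a⁻¹ = b) (h' : a * b = 1) (x : H (1 : G)) :
    TensorProduct.lift (T.umul b)
      (TensorProduct.map (T.santipode h) LinearMap.id (T.ucomul h' x)) = T.counit x • T.one b := by
  obtain rfl : a = b⁻¹ := by rw [← h, inv_inv]
  rw [← T.ax.antipode_left b x]
  simp only [ucomul, LinearMap.comp_apply]
  generalize T.comul b⁻¹ b _ = w
  induction w using TensorProduct.induction_on with
  | zero => simp
  | add x y hx hy => simp only [map_add, hx, hy]
  | tmul =>
    simp [santipode, α_symm_mul, antipode_α, α_symm_cst]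

theorem id_umul_santipode {a b : G} (h : b⁻¹ = a) (h' : a * b = 1) (x : H (1 : G)) :
    TensorProduct.lift (T.umul a)
      (TensorProduct.map LinearMap.id (T.santipode h) (T.ucomul h' x)) = T.counit x • T.one a := by
  obtain rfl : b = a⁻¹ := by rw [← h, inv_inv]
  rw [← T.ax.antipode_right a x]
  simp only [ucomul, LinearMap.comp_apply]
  generalize T.comul a a⁻¹ _ = w
  induction w using TensorProduct.induction_on with
  | zero => simp
  | add x y hx hy => simp only [map_add, hx, hy]
  | tmul =>
    simp [santipode, α_symm_mul, antipode_α, α_symm_cst]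

theorem cross_ucomul (q : G) {a b c a' b' c' : G} (h : a * b = c) (ha : q * a * q⁻¹ = a')
    (hb : q * b * q⁻¹ = b') (hc : q * c * q⁻¹ = c') (h' : a' * b' = c') (x : H c) :
    TensorProduct.map (T.cross q ha) (T.cross q hb) (T.ucomul h x)
      = T.ucomul h' (T.cross q hc x) := by
  subst h ha hb hc
  have e := T.cax.π_comul q a b x
  simp only [ucomul, cross, LinearMap.comp_apply, cst_self, LinearEquiv.coe_coe]
  rw [← e]
  generalize T.comul a b x = w
  induction w using TensorProduct.induction_on with
  | zero => simp
  | add x y hx hy => simp only [map_add, hx, hy]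
  | tmul => simp [T.cax.π_α]

theorem cross_umul (q : G) {a b : G} (h : q * a * q⁻¹ = b) (x y : H a) :
    T.cross q h (T.umul a x y) = T.umul b (T.cross q h x) (T.cross q h y) := by
  subst h
  simp [cross, π_α_symm, T.cax.π_mul]

theorem santipode_umul {a b : G} (h : a⁻¹ = b) (x y : H a) :
    T.santipode h (T.umul a x y) = T.umul b (T.santipode h y) (T.santipode h x) := by
  have hab : a * b = 1 := by rw [← h, mul_inv_cancel]
  have hba : b * a = 1 := by rw [← h, inv_mul_cancel]
  have key := convolution_left_inv_eq_right_inv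
    (tensorComul (T.ucomul (one_mul a))) (tensorComul (T.ucomul (mul_one a)))
    (tensorComul (T.ucomul hab)) (tensorComul (T.ucomul hba))
    ((TensorProduct.lid k k).toLinearMap.comp (TensorProduct.map T.counit T.counit))
    (tensorComul_coassoc _ _ _ _ (T.ucomul_coassoc hab hba (one_mul a) (mul_one a)))
    (tensorComul_counit_left _ _ (T.ucomul_counit_left _))
    (tensorComul_counit_right _ _ (T.ucomul_counit_right _))
    (T.umul b) (T.one b) (T.umul_assoc b) (T.one_umul b) (T.umul_one b)
    ((T.santipode h).comp (TensorProduct.lift (T.umul a)))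
    ((TensorProduct.lift (T.umul b).flip).comp
      (TensorProduct.map (T.santipode h) (T.santipode h)))
    (TensorProduct.lift (T.umul b)) ?_ ?_
  · simpa using LinearMap.congr_fun key (x ⊗ₜ y)
  · intro c
    induction c using TensorProduct.induction_on with
    | zero => simp
    | add x y hx hy => simp only [map_add, add_smul, hx, hy]
    | tmul x y =>
      have e := T.santipode_umul_id h hab (T.umul 1 x y)
      rw [ucomul_umul, map₂_eq_map_lift, counit_umul, ← LinearMap.comp_apply (TensorProduct.map _ _),
        ← TensorProduct.map_comp] at e
      simpa [tensorComul] using e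
  · intro c
    induction c using TensorProduct.induction_on with
    | zero => simp
    | add x y hx hy => simp only [map_add, add_smul, hx, hy]
    | tmul x y =>
      have hg : ∀ u v : H b ⊗[k] H a,
          TensorProduct.lift (T.umul b) (TensorProduct.map (TensorProduct.lift (T.umul b))
            ((TensorProduct.lift (T.umul b).flip).comp
              (TensorProduct.map (T.santipode h) (T.santipode h)))
            (TensorProduct.tensorTensorTensorComm k (H b) (H a) (H b) (H a) (u ⊗ₜ v)))
          = TensorProduct.lift (T.umul b) (TensorProduct.map
              ((T.umul b).flip (TensorProduct.lift (T.umul b)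
                (TensorProduct.map LinearMap.id (T.santipode h) v))) (T.santipode h) u) := by
        intro u v
        induction u using TensorProduct.induction_on with
        | zero => simp
        | add x y hx hy => simp only [map_add, TensorProduct.add_tmul, hx, hy]
        | tmul =>
          induction v using TensorProduct.induction_on with
          | zero => simp
          | add x y hx hy =>
            simp only [map_add, TensorProduct.tmul_add, hx, hy, TensorProduct.map_add_left,
              LinearMap.add_apply]
          | tmul =>
            simp only [TensorProduct.tensorTensorTensorComm_tmul, TensorProduct.map_tmul,
              TensorProduct.lift.tmul, LinearMap.comp_apply, LinearMap.flip_apply,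
              LinearMap.id_apply, umul_assoc]
      have e := hg (T.ucomul hba x) (T.ucomul hba y)
      rw [id_umul_santipode] at e
      have hone : (T.umul b).flip (T.counit y • T.one b) = T.counit y • LinearMap.id := by
        ext z
        rw [map_smul, LinearMap.smul_apply, LinearMap.flip_apply, umul_one]; rfl
      rw [hone, TensorProduct.map_smul_left, LinearMap.smul_apply, map_smul,
        id_umul_santipode] at e
      rw [tensorComul, LinearMap.comp_apply, TensorProduct.map_tmul]
      refine e.trans ?_
      simp [smul_smul, mul_comm]

theorem santipode_cross (q : G) {a b a' b' : G} (h : a⁻¹ = b) (h' : a'⁻¹ = b')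
    (ha : q * a * q⁻¹ = a') (hb : q * b * q⁻¹ = b') (x : H a) :
    T.santipode h' (T.cross q ha x) = T.cross q hb (T.santipode h x) := by
  have hab : a * b = 1 := by rw [← h, mul_inv_cancel]
  have hba : b * a = 1 := by rw [← h, inv_mul_cancel]
  have hab' : a' * b' = 1 := by rw [← h', mul_inv_cancel]
  have key := convolution_left_inv_eq_right_inv
    (T.ucomul (one_mul a)) (T.ucomul (mul_one a)) (T.ucomul hab) (T.ucomul hba) T.counit
    (T.ucomul_coassoc hab hba (one_mul a) (mul_one a))
    (T.ucomul_counit_left _) (T.ucomul_counit_right _)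
    (T.umul b') (T.one b') (T.umul_assoc b') (T.one_umul b') (T.umul_one b')
    ((T.santipode h').comp (T.cross q ha)) ((T.cross q hb).comp (T.santipode h))
    (T.cross q hb) ?_ ?_
  · exact LinearMap.congr_fun key x
  · intro c
    have e := T.santipode_umul_id h' hab' (T.cross q (by group) c)
    rw [← T.cross_ucomul q hab ha hb, ← LinearMap.comp_apply (TensorProduct.map _ _),
      ← TensorProduct.map_comp] at e
    have hc : T.counit (T.cross q (show q * 1 * q⁻¹ = 1 by group) c) = T.counit c :=
      T.cax.π_counit q c
    rwa [hc] at e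
  · intro c
    have hg : ∀ w : H b ⊗[k] H a,
        TensorProduct.lift (T.umul b')
          (TensorProduct.map (T.cross q hb) ((T.cross q hb).comp (T.santipode h)) w)
        = T.cross q hb (TensorProduct.lift (T.umul b)
          (TensorProduct.map LinearMap.id (T.santipode h) w)) := by
      intro w
      induction w using TensorProduct.induction_on with
      | zero => simp
      | add x y hx hy => simp only [map_add, hx, hy]
      | tmul =>
        simp only [TensorProduct.map_tmul, TensorProduct.lift.tmul, LinearMap.comp_apply,
          LinearMap.id_apply, cross_umul]
    rw [hg, id_umul_santipode, map_smul]
    congr 1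
    subst hb
    exact T.cax.π_one q b

theorem santipode_mul {a b : G} (h : a⁻¹ = b) (x y : H a) :
    T.santipode h (T.mul a x y) = T.mul b (T.santipode h y) (T.santipode h x) := by
  have e := T.santipode_umul h x y
  subst h
  simpa [santipode, antipode_α_symm] using e

end HomTC

theorem coaction_eq_map_cst {k : Type*} [Field k] {G : Type*} [Group G] {H : G → Type*}
    [∀ p, AddCommGroup (H p)] [∀ p, Module k (H p)] {M : Type*} [AddCommGroup M] [Module k M]
    (ρ : ∀ r : G, M →ₗ[k] M ⊗[k] H r) {a b : G} (h : a = b) (m : M) :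
    ρ b m = TensorProduct.map LinearMap.id (cst k h) (ρ a m) := by
  subst h
  exact (LinearMap.congr_fun TensorProduct.map_id (ρ a m)).symm

/-- The second hexagon axiom for the braiding. -/
theorem statement15 {k : Type*} [Field k] {G : Type*} [Group G] {H : G → Type*}
    [∀ p, AddCommGroup (H p)] [∀ p, Module k (H p)]
    (T : HomTC k G H) (p q s : G)
    (M : Type*) [AddCommGroup M] [Module k M] (N : Type*) [AddCommGroup N] [Module k N]
    (X : Type*) [AddCommGroup X] [Module k X]
    (μ : M ≃ₗ[k] M) (actM : H p →ₗ[k] M →ₗ[k] M) (ρM : ∀ r : G, M →ₗ[k] M ⊗[k] H r)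
    (ν : N ≃ₗ[k] N) (actN : H q →ₗ[k] N →ₗ[k] N) (ρN : ∀ r : G, N →ₗ[k] N ⊗[k] H r)
    (η : X ≃ₗ[k] X) (actX : H s →ₗ[k] X →ₗ[k] X) (ρX : ∀ r : G, X →ₗ[k] X ⊗[k] H r)
    (hM : IsYD k T p μ actM ρM) (hN : IsYD k T q ν actN ρN) (hX : IsYD k T s η actX ρX) :
    (homAssoc k η ν).symm.toLinearMap.comp
      ((braid k T s (TensorProduct.congr μ ν) (tCoact k T q ρM ρN) actX η).comp
        (homAssoc k μ η).symm.toLinearMap)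
    = (TensorProduct.map
          (braid k T (q * s * q⁻¹) μ ρM (cAct k T q s actX) η) LinearMap.id).comp
        ((homAssoc k μ ν).symm.toLinearMap.comp
          (TensorProduct.map LinearMap.id (braid k T s ν ρN actX η))) := by
  have hr : q * s⁻¹ * q⁻¹ = (q * s * q⁻¹)⁻¹ := by group
  apply TensorProduct.ext'
  intro m w
  induction w using TensorProduct.induction_on with
  | zero => simp
  | add x y hx hy => simp only [map_add, TensorProduct.tmul_add, hx, hy]
  | tmul n x => ?_
  have hμ : ∀ r : G, ρM r (μ.symm m) =
      TensorProduct.map μ.symm.toLinearMap (T.α r).symm.toLinearMap (ρM r m) := by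
    intro r
    have e := LinearMap.congr_fun (hM.ρ_μ r) (μ.symm m)
    simp only [LinearMap.comp_apply, LinearEquiv.coe_coe, LinearEquiv.apply_symm_apply] at e
    rw [e]
    generalize ρM r (μ.symm m) = u
    induction u using TensorProduct.induction_on with
    | zero => simp
    | add x y hx hy => simp only [map_add, ← hx, ← hy]
    | tmul => simp
  have hη : ∀ (a : H s) (y : X), η.symm (actX a y) = actX ((T.α s).symm a) (η.symm y) := by
    intro a y
    rw [LinearEquiv.symm_apply_eq, hX.μ_act]; simp
  have key : ∀ (a : H (q * s⁻¹ * q⁻¹)) (b : H s⁻¹),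
      η.symm (actX (T.santipode (inv_inv s) (T.mul s⁻¹ b
        (T.cross q⁻¹ (show q⁻¹ * (q * s⁻¹ * q⁻¹) * q⁻¹⁻¹ = s⁻¹ by group)
          ((T.α _).symm a)))) x)
      = cAct k T q s actX (T.santipode (inv_inv _) (cst k hr ((T.α _).symm a)))
          (η.symm (actX (T.santipode (inv_inv s) b) (η.symm x))) := by
    intro a b
    have e : T.cross q⁻¹ (show q⁻¹ * (q * s * q⁻¹) * q⁻¹⁻¹ = s by group)
          (T.santipode (inv_inv _) (cst k hr ((T.α _).symm a)))
        = T.santipode (inv_inv s) (T.cross q⁻¹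
          (show q⁻¹ * (q * s⁻¹ * q⁻¹) * q⁻¹⁻¹ = s⁻¹ by group) ((T.α _).symm a)) := by
      rw [HomTC.santipode_cst]
      exact (T.santipode_cross _ _ _ _ _ _).symm
    change _ = actX (T.cross q⁻¹ (show q⁻¹ * (q * s * q⁻¹) * q⁻¹⁻¹ = s by group)
      (T.santipode (inv_inv _) (cst k hr ((T.α _).symm a)))) _
    rw [e, HomTC.santipode_mul, hη, hη, HomTC.α_symm_mul]
    generalize T.santipode (inv_inv s) (T.cross q⁻¹ _ _) = c
    have e' := hX.act_act ((T.α s).symm c) ((T.α s).symm (T.santipode (inv_inv s) b))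
      (η.symm (η.symm x))
    rw [LinearEquiv.apply_symm_apply, LinearEquiv.apply_symm_apply] at e'
    exact e'.symm
  simp only [homAssoc, LinearEquiv.trans_symm, LinearMap.comp_apply, LinearEquiv.coe_coe,
    LinearEquiv.trans_apply, TensorProduct.congr_symm_tmul, TensorProduct.assoc_symm_tmul,
    LinearEquiv.symm_symm, LinearEquiv.refl_symm, LinearEquiv.refl_apply,
    TensorProduct.map_tmul, braid, tCoact, hμ, LinearMap.id_apply, LinearEquiv.symm_apply_apply]
  generalize ρN s⁻¹ n = v
  induction v using TensorProduct.induction_on with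
  | zero => simp
  | add x y hx hy =>
    simp only [map_add, TensorProduct.tmul_add, TensorProduct.add_tmul, hx, hy]
  | tmul n b =>
    simp only [TensorProduct.assoc_tmul, TensorProduct.map_tmul, TensorProduct.comm_tmul,
      TensorProduct.congr_symm_tmul, LinearEquiv.refl_symm, LinearEquiv.refl_apply,
      LinearEquiv.symm_symm, TensorProduct.assoc_symm_tmul, LinearMap.comp_apply,
      TensorProduct.lift.tmul, LinearEquiv.coe_coe, LinearMap.id_apply]
    rw [coaction_eq_map_cst ρM hr, hμ]
    generalize ρM (q * s⁻¹ * q⁻¹) m = u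
    induction u using TensorProduct.induction_on with
    | zero => simp
    | add x y hx hy => simp only [map_add, TensorProduct.add_tmul, hx, hy]
    | tmul m a =>
      simp only [TensorProduct.assoc_tmul, TensorProduct.map_tmul, TensorProduct.comm_tmul,
        TensorProduct.congr_symm_tmul, LinearEquiv.refl_symm, LinearEquiv.refl_apply,
        LinearEquiv.symm_symm, TensorProduct.assoc_symm_tmul, LinearMap.comp_apply,
        TensorProduct.lift.tmul, LinearEquiv.coe_coe, LinearMap.id_apply,
        TensorProduct.tensorTensorTensorComm_tmul, TensorProduct.congr_tmul,
        LinearMap.flip_apply, LinearEquiv.apply_symm_apply]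
      exact congrArg (fun y => (y ⊗ₜ[k] m) ⊗ₜ[k] ν (ν n)) (key a b)
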